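/- Let P_{0,n},…,P_{n,n} be real polynomials of two variables of degree at most n, regarded as polynomials in (z,z̄) via x = (z+z̄)/2, y = (z−z̄)/(2i), and set ℚ_n := L_n ℙ_n. Then {Q_{k,n} : 0 ≤ k ≤ n} is a basis of 𝒱_n²(w,ℂ) satisfying ℚ_n = J_{n+1} conj(ℚ_n) if and only if {P_{k,n} : 0 ≤ k ≤ n} is a basis of 𝒱_n²(W). -/

import Mathlib

open MeasureTheory MvPolynomial Matrix Complex
open scoped ComplexOrder

noncomputable section

/-- Evaluation of a polynomial in the two commuting variables `(z, z̄)` at a point `z ∈ ℂ`. -/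
def evalz (p : MvPolynomial (Fin 2) ℂ) (z : ℂ) : ℂ :=
  MvPolynomial.eval (fun i : Fin 2 => if i = 0 then z else (starRingEnd ℂ) z) p

/-- The complex inner product `⟨f,g⟩ = ∫_Ω f conj(g) w`. -/
def cip (Ω : Set ℂ) (w : ℂ → ℝ) (p q : MvPolynomial (Fin 2) ℂ) : ℂ :=
  ∫ z in Ω, evalz p z * (starRingEnd ℂ) (evalz q z) * (w z : ℂ)
/-- Conjugation of a polynomial in `(z, z̄)`: conjugate the coefficients and swap `z` and `z̄`. -/
def pconj (p : MvPolynomial (Fin 2) ℂ) : MvPolynomial (Fin 2) ℂ :=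
  MvPolynomial.rename (Equiv.swap (0 : Fin 2) 1) (MvPolynomial.map (starRingEnd ℂ) p)
/-- Membership in `𝒱_n²(w,ℂ)`: total degree at most `n` and orthogonality to all
polynomials of total degree at most `n-1`. -/
def memV (Ω : Set ℂ) (w : ℂ → ℝ) (n : ℕ) (p : MvPolynomial (Fin 2) ℂ) : Prop :=
  p.totalDegree ≤ n ∧ ∀ q : MvPolynomial (Fin 2) ℂ, q.totalDegree < n → cip Ω w p q = 0
/-- Evaluation of a real polynomial in `(x,y)` at `z = x + iy`. -/
def evalr (p : MvPolynomial (Fin 2) ℝ) (z : ℂ) : ℝ :=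
  MvPolynomial.eval (fun i : Fin 2 => if i = 0 then z.re else z.im) p

/-- The real inner product `⟨f,g⟩_W = ∫_Ω f g W`. -/
def rip (Ω : Set ℂ) (w : ℂ → ℝ) (p q : MvPolynomial (Fin 2) ℝ) : ℝ :=
  ∫ z in Ω, evalr p z * evalr q z * w z

/-- Membership in `𝒱_n²(W)`. -/
def memVR (Ω : Set ℂ) (w : ℂ → ℝ) (n : ℕ) (p : MvPolynomial (Fin 2) ℝ) : Prop :=
  p.totalDegree ≤ n ∧ ∀ q : MvPolynomial (Fin 2) ℝ, q.totalDegree < n → rip Ω w p q = 0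

/-- A real polynomial in `(x,y)` regarded as a polynomial in `(z,z̄)` via
`x = (z+z̄)/2`, `y = (z−z̄)/(2i)`. -/
def toCz (p : MvPolynomial (Fin 2) ℝ) : MvPolynomial (Fin 2) ℂ :=
  MvPolynomial.aeval
    (fun i : Fin 2 => if i = 0 then (C (2⁻¹ : ℂ) * (X 0 + X 1) : MvPolynomial (Fin 2) ℂ)
      else C (-Complex.I / 2) * (X 0 - X 1))
    (MvPolynomial.map (algebraMap ℝ ℂ) p)

/-- The `m × m` backward identity matrix. -/
def Jmat (m : ℕ) : Matrix (Fin m) (Fin m) ℂ :=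
  fun r s => if r.1 + s.1 = m - 1 then 1 else 0

/-- The unitary matrix `L_n` relating real and complex orthogonal polynomials. -/
def Lmat (n : ℕ) : Matrix (Fin (n+1)) (Fin (n+1)) ℂ :=
  fun k j =>
    if 2 * k.1 < n then
      (if j = k then ((Real.sqrt 2 : ℝ)⁻¹ : ℂ) else 0)
        + (if j.1 = n - k.1 then -Complex.I * ((Real.sqrt 2 : ℝ)⁻¹ : ℂ) else 0)
    else if 2 * k.1 = n then (if j = k then 1 else 0)
    else
      (if j.1 = n - k.1 then ((Real.sqrt 2 : ℝ)⁻¹ : ℂ) else 0)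
        + (if j = k then Complex.I * ((Real.sqrt 2 : ℝ)⁻¹ : ℂ) else 0)

/-- `ℚ_n = L_n ℙ_n`: the complex polynomial vector obtained from a real one. -/
def LQ (n : ℕ) (P : Fin (n+1) → MvPolynomial (Fin 2) ℝ) :
    Fin (n+1) → MvPolynomial (Fin 2) ℂ :=
  fun k => ∑ j, Lmat n k j • toCz (P j)

lemma toCz_add (a b : MvPolynomial (Fin 2) ℝ) : toCz (a + b) = toCz a + toCz b := by
  simp [toCz]

lemma toCz_mul (a b : MvPolynomial (Fin 2) ℝ) : toCz (a * b) = toCz a * toCz b := by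
  simp [toCz]

lemma toCz_C (r : ℝ) : toCz (C r) = C (r : ℂ) := by
  simp [toCz, MvPolynomial.algebraMap_eq]

lemma toCz_smul (r : ℝ) (a : MvPolynomial (Fin 2) ℝ) : toCz (r • a) = (r : ℂ) • toCz a := by
  rw [MvPolynomial.smul_eq_C_mul, toCz_mul, toCz_C, MvPolynomial.smul_eq_C_mul]

/-- `toCz` as a real-linear map. -/
def toCzLinear : MvPolynomial (Fin 2) ℝ →ₗ[ℝ] MvPolynomial (Fin 2) ℂ where
  toFun := toCz
  map_add' := toCz_add
  map_smul' r a := by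
    rw [toCz_smul]
    exact (algebraMap_smul ℂ r (toCz a))

lemma toCz_zero : toCz 0 = 0 := toCzLinear.map_zero

lemma toCz_sum {ι : Type*} (s : Finset ι) (f : ι → MvPolynomial (Fin 2) ℝ) :
    toCz (∑ i ∈ s, f i) = ∑ i ∈ s, toCz (f i) := map_sum toCzLinear f s

lemma evalz_toCz (a : MvPolynomial (Fin 2) ℝ) (z : ℂ) : evalz (toCz a) z = (evalr a z : ℂ) := by
  induction a using MvPolynomial.induction_on with
  | C r => rw [toCz_C]; simp [evalz, evalr]
  | add p q hp hq =>
    rw [toCz_add]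
    simp only [evalz, evalr, map_add, ofReal_add] at *
    rw [hp, hq]
  | mul_X p i hp =>
    rw [toCz_mul]
    simp only [evalz, evalr, map_mul, ofReal_mul] at *
    rw [hp]
    congr 1
    fin_cases i
    · simp [toCz, Complex.ext_iff]
      ring
    · simp [toCz, Complex.ext_iff]
      ring

lemma evalz_add (p q : MvPolynomial (Fin 2) ℂ) (z : ℂ) :
    evalz (p + q) z = evalz p z + evalz q z := by
  simp [evalz]

lemma evalz_smul (c : ℂ) (p : MvPolynomial (Fin 2) ℂ) (z : ℂ) :
    evalz (c • p) z = c * evalz p z := by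
  simp [evalz]

lemma evalz_zero (z : ℂ) : evalz 0 z = 0 := by
  simp [evalz]

lemma eq_zero_of_evalr_eq_zero {a : MvPolynomial (Fin 2) ℝ} (h : ∀ z, evalr a z = 0) : a = 0 := by
  refine MvPolynomial.funext fun v => ?_
  have hv := h ⟨v 0, v 1⟩
  rw [map_zero, ← hv, evalr]
  congr 2
  funext i
  fin_cases i <;> rfl

lemma toCz_add_I_smul_eq_zero {a b : MvPolynomial (Fin 2) ℝ}
    (h : toCz a + I • toCz b = 0) : a = 0 ∧ b = 0 := by
  have key : ∀ z, evalr a z = 0 ∧ evalr b z = 0 := fun z => by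
    have hz := congrArg (fun p => evalz p z) h
    simp only [evalz_add, evalz_smul, evalz_toCz, evalz_zero] at hz
    simpa [Complex.ext_iff] using hz
  exact ⟨eq_zero_of_evalr_eq_zero fun z => (key z).1, eq_zero_of_evalr_eq_zero fun z => (key z).2⟩

lemma toCz_add_I_smul_inj {a b c d : MvPolynomial (Fin 2) ℝ}
    (h : toCz a + I • toCz b = toCz c + I • toCz d) : a = c ∧ b = d := by
  have h' : toCz (a - c) + I • toCz (b - d) = 0 := by
    have e := fun p q => map_sub toCzLinear p q
    change ∀ p q, toCz (p - q) = toCz p - toCz q at e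
    rw [e, e, smul_sub]
    linear_combination h
  simpa [sub_eq_zero] using toCz_add_I_smul_eq_zero h'

lemma totalDegree_aeval_le {K : Type*} [Field K] {f : Fin 2 → MvPolynomial (Fin 2) K}
    (hf : ∀ i, (f i).totalDegree ≤ 1) (p : MvPolynomial (Fin 2) K) :
    (aeval f p).totalDegree ≤ p.totalDegree := by
  rw [aeval_def, eval₂_eq]
  refine totalDegree_finsetSum_le fun d hd => ?_
  refine (totalDegree_mul _ _).trans ?_
  rw [MvPolynomial.algebraMap_eq, totalDegree_C, zero_add]
  refine (totalDegree_finsetProd _ _).trans ?_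
  refine le_trans (Finset.sum_le_sum fun i _ => ?_) (le_totalDegree hd)
  exact (totalDegree_pow _ _).trans (by simpa using Nat.mul_le_mul_left (d i) (hf i))

lemma totalDegree_C_mul_le {K : Type*} [Field K] (c : K) (p : MvPolynomial (Fin 2) K) :
    (C c * p).totalDegree ≤ p.totalDegree :=
  (totalDegree_mul _ _).trans (by simp)

lemma totalDegree_toCz_le (a : MvPolynomial (Fin 2) ℝ) :
    (toCz a).totalDegree ≤ a.totalDegree := by
  refine (totalDegree_aeval_le (fun i => ?_) _).trans ?_
  · split_ifs
    · exact (totalDegree_C_mul_le _ _).trans ((totalDegree_add _ _).trans (by simp))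
    · exact (totalDegree_C_mul_le _ _).trans ((totalDegree_sub _ _).trans (by simp))
  · exact Finset.sup_mono (support_map_subset _ _)

/-- Apply a function `ℂ → ℝ` to the coefficients of a complex polynomial. -/
def coeffPart (f : ℂ → ℝ) (p : MvPolynomial (Fin 2) ℂ) : MvPolynomial (Fin 2) ℝ :=
  ∑ m ∈ p.support, monomial m (f (coeff m p))

lemma coeff_coeffPart {f : ℂ → ℝ} (hf : f 0 = 0) (p : MvPolynomial (Fin 2) ℂ) (m : Fin 2 →₀ ℕ) :
    coeff m (coeffPart f p) = f (coeff m p) := by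
  classical
  simp only [coeffPart, coeff_sum, coeff_monomial, Finset.sum_ite_eq', mem_support_iff]
  split_ifs with h
  · rfl
  · rw [not_not.mp h, hf]

lemma totalDegree_coeffPart_le {f : ℂ → ℝ} (hf : f 0 = 0) (p : MvPolynomial (Fin 2) ℂ) :
    (coeffPart f p).totalDegree ≤ p.totalDegree := by
  refine Finset.sup_mono fun m hm => ?_
  rw [mem_support_iff, coeff_coeffPart hf] at hm
  rw [mem_support_iff]
  exact fun h => hm (by rw [h, hf])

lemma exists_eq_toCz_add_I_smul (p : MvPolynomial (Fin 2) ℂ) :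
    ∃ a b : MvPolynomial (Fin 2) ℝ, p = toCz a + I • toCz b ∧
      a.totalDegree ≤ p.totalDegree ∧ b.totalDegree ≤ p.totalDegree := by
  set g : Fin 2 → MvPolynomial (Fin 2) ℂ :=
    fun i => if i = 0 then X 0 + C I * X 1 else X 0 - C I * X 1 with hg
  have hgdeg : (aeval g p).totalDegree ≤ p.totalDegree := totalDegree_aeval_le (fun i => by
    have h1 : (C I * X 1 : MvPolynomial (Fin 2) ℂ).totalDegree ≤ 1 :=
      (totalDegree_C_mul_le _ _).trans (by simp)
    simp only [hg]
    split_ifs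
    · exact (totalDegree_add _ _).trans (by simpa using h1)
    · exact (totalDegree_sub _ _).trans (by simpa using h1)) p
  refine ⟨coeffPart re (aeval g p), coeffPart im (aeval g p), ?_,
    (totalDegree_coeffPart_le rfl _).trans hgdeg, (totalDegree_coeffPart_le rfl _).trans hgdeg⟩
  have hdecomp : map (algebraMap ℝ ℂ) (coeffPart re (aeval g p)) +
      I • map (algebraMap ℝ ℂ) (coeffPart im (aeval g p)) = aeval g p := by
    ext m
    rw [coeff_add, coeff_smul, coeff_map, coeff_map, coeff_coeffPart rfl, coeff_coeffPart rfl,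
      smul_eq_mul, mul_comm]
    exact re_add_im _
  rw [toCz, toCz, ← map_smul, ← map_add, hdecomp, ← AlgHom.comp_apply]
  conv_lhs => rw [← AlgHom.id_apply (R := ℂ) p]
  congr 1
  have hI : (C I * C (-I / 2) : MvPolynomial (Fin 2) ℂ) = C 2⁻¹ := by
    rw [← C_mul]
    congr 1
    linear_combination (-1 / 2 : ℂ) * I_mul_I
  have h2 : (C 2⁻¹ * 2 : MvPolynomial (Fin 2) ℂ) = 1 := by
    rw [show (2 : MvPolynomial (Fin 2) ℂ) = C 2 from (map_ofNat C 2).symm, ← C_mul]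
    simp
  ext1 i
  fin_cases i
  · simp [hg, MvPolynomial.algebraMap_eq]
    linear_combination (-(X 0 - X 1) : MvPolynomial (Fin 2) ℂ) * hI - X 0 * h2
  · simp [hg, MvPolynomial.algebraMap_eq]
    linear_combination ((X 0 - X 1) : MvPolynomial (Fin 2) ℂ) * hI - X 1 * h2

lemma pconj_add (p q : MvPolynomial (Fin 2) ℂ) : pconj (p + q) = pconj p + pconj q := by
  simp [pconj]

lemma pconj_smul (c : ℂ) (p : MvPolynomial (Fin 2) ℂ) :
    pconj (c • p) = (starRingEnd ℂ) c • pconj p := by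
  simp [pconj, MvPolynomial.smul_eq_C_mul]

lemma pconj_toCz (a : MvPolynomial (Fin 2) ℝ) : pconj (toCz a) = toCz a := by
  induction a using MvPolynomial.induction_on with
  | C r => rw [toCz_C]; simp [pconj]
  | add p q hp hq => rw [toCz_add, pconj_add, hp, hq]
  | mul_X p i hp =>
    have hX : pconj (toCz (X i)) = toCz (X i) := by
      fin_cases i
      · simp [toCz, pconj, add_comm, Complex.conj_ofNat]
      · simp only [toCz, pconj, map_X, aeval_X]
        simp [neg_div, Complex.conj_ofNat]
        ring
    rw [toCz_mul]
    conv_rhs => rw [← hp, ← hX]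
    simp [pconj]

section InnerProduct

variable {Ω : Set ℂ} {w : ℂ → ℝ}

lemma cip_toCz (a b : MvPolynomial (Fin 2) ℝ) :
    cip Ω w (toCz a) (toCz b) = (rip Ω w a b : ℂ) := by
  rw [cip, rip, ← integral_complex_ofReal]
  simp [evalz_toCz]

lemma cip_smul_left (c : ℂ) (p q : MvPolynomial (Fin 2) ℂ) :
    cip Ω w (c • p) q = c * cip Ω w p q := by
  simp only [cip, evalz_smul, mul_assoc, integral_const_mul]

lemma cip_smul_right (c : ℂ) (p q : MvPolynomial (Fin 2) ℂ) :
    cip Ω w p (c • q) = (starRingEnd ℂ) c * cip Ω w p q := by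
  simp only [cip, evalz_smul, map_mul, ← integral_const_mul]
  congr 1
  funext z
  ring

lemma cip_add_left (hIntC : ∀ p q : MvPolynomial (Fin 2) ℂ,
      IntegrableOn (fun z => evalz p z * (starRingEnd ℂ) (evalz q z) * (w z : ℂ)) Ω)
    (p p' q : MvPolynomial (Fin 2) ℂ) :
    cip Ω w (p + p') q = cip Ω w p q + cip Ω w p' q := by
  rw [cip, cip, cip, ← integral_add (hIntC p q) (hIntC p' q)]
  simp only [evalz_add, add_mul]

lemma cip_add_right (hIntC : ∀ p q : MvPolynomial (Fin 2) ℂ,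
      IntegrableOn (fun z => evalz p z * (starRingEnd ℂ) (evalz q z) * (w z : ℂ)) Ω)
    (p q q' : MvPolynomial (Fin 2) ℂ) :
    cip Ω w p (q + q') = cip Ω w p q + cip Ω w p q' := by
  rw [cip, cip, cip, ← integral_add (hIntC p q) (hIntC p q')]
  simp only [evalz_add, map_add, mul_add, add_mul]

/-- The complex orthogonal polynomials of degree `n` as a subspace. -/
def orthSubmodule (hIntC : ∀ p q : MvPolynomial (Fin 2) ℂ,
      IntegrableOn (fun z => evalz p z * (starRingEnd ℂ) (evalz q z) * (w z : ℂ)) Ω) (n : ℕ) :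
    Submodule ℂ (MvPolynomial (Fin 2) ℂ) where
  carrier := {p | memV Ω w n p}
  add_mem' := fun {p q} hp hq => ⟨(totalDegree_add p q).trans (max_le hp.1 hq.1), fun r hr => by
    rw [cip_add_left hIntC, hp.2 r hr, hq.2 r hr, add_zero]⟩
  zero_mem' := ⟨by simp, fun r _ => by simp [cip, evalz_zero]⟩
  smul_mem' c p hp := ⟨(totalDegree_smul_le c p).trans hp.1, fun r hr => by
    rw [cip_smul_left, hp.2 r hr, mul_zero]⟩

lemma memVR_of_memV (hIntC : ∀ p q : MvPolynomial (Fin 2) ℂ,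
      IntegrableOn (fun z => evalz p z * (starRingEnd ℂ) (evalz q z) * (w z : ℂ)) Ω)
    {n : ℕ} {a b : MvPolynomial (Fin 2) ℝ} (h : memV Ω w n (toCz a + I • toCz b)) :
    memVR Ω w n a ∧ memVR Ω w n b := by
  obtain ⟨a', b', hab, ha', hb'⟩ := exists_eq_toCz_add_I_smul (toCz a + I • toCz b)
  obtain ⟨rfl, rfl⟩ := toCz_add_I_smul_inj hab
  have key : ∀ q : MvPolynomial (Fin 2) ℝ, q.totalDegree < n →
      rip Ω w a q = 0 ∧ rip Ω w b q = 0 := fun q hq => by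
    have hz := h.2 (toCz q) ((totalDegree_toCz_le q).trans_lt hq)
    rw [cip_add_left hIntC, cip_smul_left, cip_toCz, cip_toCz] at hz
    simpa [Complex.ext_iff] using hz
  exact ⟨⟨ha'.trans h.1, fun q hq => (key q hq).1⟩, ⟨hb'.trans h.1, fun q hq => (key q hq).2⟩⟩

lemma memV_toCz_iff (hIntC : ∀ p q : MvPolynomial (Fin 2) ℂ,
      IntegrableOn (fun z => evalz p z * (starRingEnd ℂ) (evalz q z) * (w z : ℂ)) Ω)
    {n : ℕ} {a : MvPolynomial (Fin 2) ℝ} : memV Ω w n (toCz a) ↔ memVR Ω w n a := by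
  constructor
  · intro h
    refine (memVR_of_memV (b := 0) hIntC ?_).1
    simpa [toCz_zero] using h
  · intro h
    refine ⟨(totalDegree_toCz_le a).trans h.1, fun q hq => ?_⟩
    obtain ⟨c, d, rfl, hc, hd⟩ := exists_eq_toCz_add_I_smul q
    rw [cip_add_right hIntC, cip_smul_right, cip_toCz, cip_toCz, h.2 c (hc.trans_lt hq),
      h.2 d (hd.trans_lt hq)]
    simp

end InnerProduct

section Families

variable {ι : Type*} [Fintype ι]

lemma sum_smul_toCz (P : ι → MvPolynomial (Fin 2) ℝ) (c : ι → ℂ) :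
    ∑ k, c k • toCz (P k) =
      toCz (∑ k, (c k).re • P k) + I • toCz (∑ k, (c k).im • P k) := by
  simp only [toCz_sum, toCz_smul, Finset.smul_sum, smul_smul, ← Finset.sum_add_distrib, ← add_smul]
  refine Finset.sum_congr rfl fun k _ => ?_
  rw [mul_comm I, re_add_im]

lemma linearIndependent_toCz_iff (P : ι → MvPolynomial (Fin 2) ℝ) :
    LinearIndependent ℂ (fun k => toCz (P k)) ↔ LinearIndependent ℝ P := by
  constructor
  · intro h
    exact LinearIndependent.of_comp toCzLinear (h.restrict_scalars' ℝ)
  · intro h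
    rw [Fintype.linearIndependent_iff] at h ⊢
    intro c hc k
    rw [sum_smul_toCz] at hc
    obtain ⟨hre, him⟩ := toCz_add_I_smul_eq_zero hc
    exact Complex.ext (h _ hre k) (h _ him k)

lemma add_I_smul_mem_span_toCz_iff (P : ι → MvPolynomial (Fin 2) ℝ)
    (a b : MvPolynomial (Fin 2) ℝ) :
    toCz a + I • toCz b ∈ Submodule.span ℂ (Set.range fun k => toCz (P k)) ↔
      a ∈ Submodule.span ℝ (Set.range P) ∧ b ∈ Submodule.span ℝ (Set.range P) := by
  simp only [Submodule.mem_span_range_iff_exists_fun]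
  constructor
  · rintro ⟨c, hc⟩
    rw [sum_smul_toCz] at hc
    obtain ⟨hre, him⟩ := toCz_add_I_smul_inj hc
    exact ⟨⟨_, hre⟩, ⟨_, him⟩⟩
  · rintro ⟨⟨c, rfl⟩, ⟨d, rfl⟩⟩
    exact ⟨fun k => ⟨c k, d k⟩, sum_smul_toCz P _⟩

lemma forall_memV_mem_span_iff {Ω : Set ℂ} {w : ℂ → ℝ}
    (hIntC : ∀ p q : MvPolynomial (Fin 2) ℂ,
      IntegrableOn (fun z => evalz p z * (starRingEnd ℂ) (evalz q z) * (w z : ℂ)) Ω)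
    (n : ℕ) (P : ι → MvPolynomial (Fin 2) ℝ) :
    (∀ p, memV Ω w n p → p ∈ Submodule.span ℂ (Set.range fun k => toCz (P k))) ↔
      ∀ p, memVR Ω w n p → p ∈ Submodule.span ℝ (Set.range P) := by
  constructor
  · intro h p hp
    refine ((add_I_smul_mem_span_toCz_iff P p 0).mp ?_).1
    simpa [toCz_zero] using h _ ((memV_toCz_iff hIntC).mpr hp)
  · intro h p hp
    obtain ⟨a, b, rfl, -, -⟩ := exists_eq_toCz_add_I_smul p
    obtain ⟨ha, hb⟩ := memVR_of_memV hIntC hp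
    exact (add_I_smul_mem_span_toCz_iff P a b).mpr ⟨h a ha, h b hb⟩

lemma linearIndependent_iff_of_span_eq {K V : Type*} [DivisionRing K] [AddCommGroup V] [Module K V]
    {u v : ι → V} (h : Submodule.span K (Set.range u) = Submodule.span K (Set.range v)) :
    LinearIndependent K u ↔ LinearIndependent K v := by
  rw [linearIndependent_iff_card_eq_finrank_span, linearIndependent_iff_card_eq_finrank_span,
    Set.finrank, Set.finrank, h]

end Families

section Lmat

variable {n : ℕ} (P : Fin (n + 1) → MvPolynomial (Fin 2) ℝ) (k : Fin (n + 1))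

lemma val_eq_sub_iff (j : Fin (n + 1)) : j.1 = n - k.1 ↔ j = k.rev := by
  rw [Fin.ext_iff, Fin.val_rev]
  omega

lemma LQ_of_lt (hk : 2 * k.1 < n) :
    LQ n P k = ((√2 : ℝ) : ℂ)⁻¹ • (toCz (P k) - I • toCz (P k.rev)) := by
  simp only [LQ, Lmat, hk, if_true, val_eq_sub_iff, add_smul, ite_smul, zero_smul,
    Finset.sum_add_distrib, Finset.sum_ite_eq', Finset.mem_univ]
  module

lemma LQ_of_eq (hk : 2 * k.1 = n) : LQ n P k = toCz (P k) := by
  simp only [LQ, Lmat, hk, lt_irrefl, if_false, if_true, ite_smul, zero_smul, one_smul,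
    Finset.sum_ite_eq', Finset.mem_univ]

lemma LQ_of_gt (hk : n < 2 * k.1) :
    LQ n P k = ((√2 : ℝ) : ℂ)⁻¹ • (toCz (P k.rev) + I • toCz (P k)) := by
  simp only [LQ, Lmat, hk.not_gt, hk.ne', if_false, if_true, val_eq_sub_iff, add_smul, ite_smul,
    zero_smul, Finset.sum_add_distrib, Finset.sum_ite_eq', Finset.mem_univ]
  module

lemma LQ_eq_pconj_rev : LQ n P k = pconj (LQ n P k.rev) := by
  have hrev : k.rev.1 = n - k.1 := (val_eq_sub_iff k _).mpr rfl
  have hle : k.1 ≤ n := Nat.lt_succ_iff.mp k.2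
  rcases lt_trichotomy (2 * k.1) n with hk | hk | hk
  · rw [LQ_of_lt P k hk, LQ_of_gt P k.rev (by omega), Fin.rev_rev]
    simp only [pconj_smul, pconj_add, pconj_toCz, map_inv₀, conj_ofReal, conj_I]
    module
  · have : k.rev = k := Fin.ext (by omega)
    rw [this, LQ_of_eq P k hk, pconj_toCz]
  · rw [LQ_of_gt P k hk, LQ_of_lt P k.rev (by omega), Fin.rev_rev]
    simp only [sub_eq_add_neg, ← neg_smul, pconj_smul, pconj_add, pconj_toCz, map_inv₀,
      conj_ofReal, conj_I, map_neg, neg_neg]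

lemma toCz_mem_span_LQ : toCz (P k) ∈ Submodule.span ℂ (Set.range (LQ n P)) := by
  have hrev : k.rev.1 = n - k.1 := (val_eq_sub_iff k _).mpr rfl
  have hle : k.1 ≤ n := Nat.lt_succ_iff.mp k.2
  have hs : ((√2 : ℝ) : ℂ) ≠ 0 := by simp
  have hmem : ∀ j, LQ n P j ∈ Submodule.span ℂ (Set.range (LQ n P)) :=
    fun j => Submodule.subset_span ⟨j, rfl⟩
  have hcomb : ∀ a b : ℂ, a • LQ n P k + b • LQ n P k.rev ∈
      Submodule.span ℂ (Set.range (LQ n P)) := fun a b =>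
    add_mem (Submodule.smul_mem _ a (hmem k)) (Submodule.smul_mem _ b (hmem k.rev))
  rcases lt_trichotomy (2 * k.1) n with hk | hk | hk
  · convert hcomb (2⁻¹ * (√2 : ℝ)) (2⁻¹ * (√2 : ℝ)) using 1
    rw [LQ_of_lt P k hk, LQ_of_gt P k.rev (by omega), Fin.rev_rev, smul_smul, smul_smul,
      mul_inv_cancel_right₀ hs]
    module
  · rw [← LQ_of_eq P k hk]
    exact hmem k
  · convert hcomb (-I * 2⁻¹ * (√2 : ℝ)) (I * 2⁻¹ * (√2 : ℝ)) using 1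
    rw [LQ_of_gt P k hk, LQ_of_lt P k.rev (by omega), Fin.rev_rev, smul_smul, smul_smul,
      mul_inv_cancel_right₀ hs, mul_inv_cancel_right₀ hs]
    match_scalars
    · linear_combination I_mul_I
    · ring

lemma span_range_LQ :
    Submodule.span ℂ (Set.range (LQ n P)) = Submodule.span ℂ (Set.range fun k => toCz (P k)) := by
  apply le_antisymm <;> rw [Submodule.span_le, Set.range_subset_iff]
  · exact fun k => Submodule.sum_mem _ fun j _ =>
      Submodule.smul_mem _ _ (Submodule.subset_span ⟨j, rfl⟩)
  · exact toCz_mem_span_LQ P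

end Lmat

/-- With `ℚ_n := L_n ℙ_n`, the family `{Q_{k,n}}` is a basis of
`𝒱_n²(w,ℂ)` satisfying `ℚ_n = J_{n+1} conj(ℚ_n)` if and only if `{P_{k,n}}` is a basis
of `𝒱_n²(W)`. -/
theorem stmt_5 (Ω : Set ℂ) (w : ℂ → ℝ)
    (hw : ∀ z ∈ Ω, 0 ≤ w z)
    (hnorm : (∫ z in Ω, w z) = 1)
    (hIntC : ∀ p q : MvPolynomial (Fin 2) ℂ,
      IntegrableOn (fun z => evalz p z * (starRingEnd ℂ) (evalz q z) * (w z : ℂ)) Ω)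
    (hIntR : ∀ p q : MvPolynomial (Fin 2) ℝ,
      IntegrableOn (fun z => evalr p z * evalr q z * w z) Ω)
    (hposR : ∀ p : MvPolynomial (Fin 2) ℝ, p ≠ 0 → 0 < rip Ω w p p)
    (n : ℕ) (P : Fin (n+1) → MvPolynomial (Fin 2) ℝ) :
    ((∀ k, memV Ω w n (LQ n P k)) ∧ LinearIndependent ℂ (LQ n P) ∧
      (∀ p, memV Ω w n p → p ∈ Submodule.span ℂ (Set.range (LQ n P))) ∧
      (∀ k, LQ n P k = pconj (LQ n P k.rev)))
    ↔ ((∀ k, memVR Ω w n (P k)) ∧ LinearIndependent ℝ P ∧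
      (∀ p, memVR Ω w n p → p ∈ Submodule.span ℝ (Set.range P))) := by
  have hspan := span_range_LQ P
  have hmem : (∀ k, memV Ω w n (LQ n P k)) ↔ ∀ k, memVR Ω w n (P k) := by
    simp only [← memV_toCz_iff hIntC]
    have h (u : Fin (n + 1) → MvPolynomial (Fin 2) ℂ) : (∀ k, memV Ω w n (u k)) ↔
        Submodule.span ℂ (Set.range u) ≤ orthSubmodule hIntC n := by
      rw [Submodule.span_le, Set.range_subset_iff]
      rfl
    rw [h, h, hspan]
  rw [hmem, linearIndependent_iff_of_span_eq hspan, linearIndependent_toCz_iff, hspan,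
    forall_memV_mem_span_iff hIntC]
  simp only [and_iff_left (LQ_eq_pconj_rev P)]
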